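/- With P, E as in the definition of the censored matrix, if P is irreducible then the censored matrix P^E is irreducible. -/

import Mathlib

open scoped BigOperators

section Censor

variable {S : Type*} [Fintype S] [DecidableEq S]

/-- The block `Q` of `P` indexed by the complement of `E = {x | p x}`. -/
def Qpart (P : Matrix S S ℝ) (p : S → Prop) [DecidablePred p] :
    Matrix {x // ¬ p x} {x // ¬ p x} ℝ :=
  Matrix.of fun a b => P a.1 b.1

/-- The censored matrix `P^E = T + U (I - Q)⁻¹ D` on `E = {x | p x}`. -/
noncomputable def censor (P : Matrix S S ℝ) (p : S → Prop) [DecidablePred p] :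
    Matrix {x // p x} {x // p x} ℝ :=
  (Matrix.of fun (a b : {x // p x}) => P a.1 b.1) +
    (Matrix.of fun (a : {x // p x}) (b : {x // ¬ p x}) => P a.1 b.1) *
      (1 - Qpart P p)⁻¹ *
    (Matrix.of fun (a : {x // ¬ p x}) (b : {x // p x}) => P a.1 b.1)

end Censor

/-- A nonnegative square matrix indexed by a finite set is irreducible if for every pair of
indices `(x, y)` there exists `k ≥ 1` with `(A^k)_{x,y} > 0`. -/
def Matrix.Irred {ι : Type*} [Fintype ι] [DecidableEq ι] (A : Matrix ι ι ℝ) : Prop :=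
  ∀ x y, ∃ k : ℕ, 1 ≤ k ∧ 0 < (A ^ k) x y

theorem Matrix.mul_apply_pos {l m n : Type*} [Fintype m]
    {A : Matrix l m ℝ} {B : Matrix m n ℝ} (hA : ∀ x y, 0 ≤ A x y) (hB : ∀ x y, 0 ≤ B x y)
    {x : l} {y : m} {z : n} (hxy : 0 < A x y) (hyz : 0 < B y z) : 0 < (A * B) x z := by
  rw [Matrix.mul_apply]
  exact Finset.sum_pos' (fun w _ => mul_nonneg (hA x w) (hB w z))
    ⟨y, Finset.mem_univ y, mul_pos hxy hyz⟩

theorem Matrix.mul_apply_nonneg {l m n : Type*} [Fintype m]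
    {A : Matrix l m ℝ} {B : Matrix m n ℝ} (hA : ∀ x y, 0 ≤ A x y) (hB : ∀ x y, 0 ≤ B x y)
    (x : l) (z : n) : 0 ≤ (A * B) x z := by
  rw [Matrix.mul_apply]
  exact Finset.sum_nonneg fun w _ => mul_nonneg (hA x w) (hB w z)

theorem Matrix.transGen_of_pow_apply_pos {ι : Type*} [Fintype ι] [DecidableEq ι]
    {A : Matrix ι ι ℝ} (hA : ∀ x y, 0 ≤ A x y) (k : ℕ) {x y : ι}
    (h : 0 < (A ^ (k + 1)) x y) : Relation.TransGen (fun a b => 0 < A a b) x y := by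
  induction k generalizing y with
  | zero => exact .single (by simpa using h)
  | succ k ih =>
    rw [pow_succ, Matrix.mul_apply] at h
    obtain ⟨z, -, hz⟩ := Finset.exists_ne_zero_of_sum_ne_zero h.ne'
    exact (ih <| (Matrix.pow_apply_nonneg hA _ x z).lt_of_ne' (left_ne_zero_of_mul hz)).tail
      ((hA z y).lt_of_ne' (right_ne_zero_of_mul hz))

theorem Matrix.irred_iff_transGen {ι : Type*} [Fintype ι] [DecidableEq ι]
    {A : Matrix ι ι ℝ} (hA : ∀ x y, 0 ≤ A x y) :
    A.Irred ↔ ∀ x y, Relation.TransGen (fun a b => 0 < A a b) x y := by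
  refine ⟨fun h x y => ?_, fun h x y => ?_⟩
  · obtain ⟨k, hk, hpos⟩ := h x y
    obtain ⟨j, rfl⟩ := Nat.exists_eq_add_of_le' hk
    exact Matrix.transGen_of_pow_apply_pos hA j hpos
  · induction h x y with
    | single hxy => exact ⟨1, le_rfl, by simpa using hxy⟩
    | tail _ hyz ih =>
      obtain ⟨k, -, hpos⟩ := ih
      exact ⟨k + 1, Nat.le_add_left 1 k, pow_succ A k ▸
        Matrix.mul_apply_pos (Matrix.pow_apply_nonneg hA k) hA hpos hyz⟩

theorem Matrix.tsum_apply_nonneg {ι m n : Type*} {f : ι → Matrix m n ℝ}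
    (hf : ∀ i x y, 0 ≤ f i x y) (x : m) (y : n) : 0 ≤ (∑' i, f i) x y := by
  by_cases h : Summable f
  · exact (Pi.hasSum.1 (Pi.hasSum.1 h.hasSum x) y).nonneg fun i => hf i x y
  · simp [tsum_eq_zero_of_not_summable h]

theorem stmt8 {S : Type*} [Fintype S] [DecidableEq S]
    (P : Matrix S S ℝ) (p : S → Prop) [DecidablePred p]
    (hne : ∃ x, p x)
    (hPnn : ∀ x y, 0 ≤ P x y) (hProw : ∀ x, ∑ y, P x y = 1)
    (hQinv : IsUnit (1 - Qpart P p))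
    (hNeu : (1 - Qpart P p)⁻¹ = ∑' n : ℕ, (Qpart P p) ^ n)
    (hirr : P.Irred) :
    (censor P p).Irred := by
  set Q := Qpart P p
  set N := (1 - Q)⁻¹
  set U : Matrix {x // p x} {x // ¬ p x} ℝ := Matrix.of fun a b => P a.1 b.1
  set D : Matrix {x // ¬ p x} {x // p x} ℝ := Matrix.of fun a b => P a.1 b.1
  have hQnn : ∀ x y, 0 ≤ Q x y := fun x y => hPnn x.1 y.1
  have hUnn : ∀ x y, 0 ≤ U x y := fun x y => hPnn x.1 y.1
  have hDnn : ∀ x y, 0 ≤ D x y := fun x y => hPnn x.1 y.1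
  have hNnn : ∀ x y, 0 ≤ N x y := fun x y =>
    hNeu ▸ Matrix.tsum_apply_nonneg (fun n => Matrix.pow_apply_nonneg hQnn n) x y
  have hNDnn : ∀ x y, 0 ≤ (N * D) x y := Matrix.mul_apply_nonneg hNnn hDnn
  have hND : N * D = D + Q * (N * D) := by
    have h : (1 - Q) * N = 1 :=
      Matrix.mul_nonsing_inv _ ((Matrix.isUnit_iff_isUnit_det _).1 hQinv)
    rw [sub_mul, one_mul, sub_eq_iff_eq_add] at h
    rw [← Matrix.mul_assoc]
    nth_rewrite 1 [h]
    rw [Matrix.add_mul, Matrix.one_mul]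
  have hC : ∀ a b, censor P p a b = P a.1 b.1 + (U * (N * D)) a b := fun a b => by
    rw [← Matrix.mul_assoc]
    rfl
  have hCnn : ∀ a b, 0 ≤ censor P p a b := fun a b =>
    hC a b ▸ add_nonneg (hPnn _ _) (Matrix.mul_apply_nonneg hUnn hNDnn a b)
  have direct : ∀ a b : {x // p x}, 0 < P a.1 b.1 → 0 < censor P p a b := fun a b h =>
    hC a b ▸ add_pos_of_pos_of_nonneg h (Matrix.mul_apply_nonneg hUnn hNDnn a b)
  have enter : ∀ (a : {x // ¬ p x}) (b : {x // p x}), 0 < P a.1 b.1 → 0 < (N * D) a b :=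
    fun a b h => by
      rw [hND]
      exact add_pos_of_pos_of_nonneg h (Matrix.mul_apply_nonneg hQnn hNDnn a b)
  rw [Matrix.irred_iff_transGen hPnn] at hirr
  rw [Matrix.irred_iff_transGen hCnn]
  intro x y
  -- From outside `E`, follow the path up to its first entrance into `E`.
  have key : ∀ w : S,
      (∀ hw : p w, Relation.TransGen (fun a b => 0 < censor P p a b) ⟨w, hw⟩ y) ∧
      (∀ hw : ¬ p w, ∃ z, 0 < (N * D) ⟨w, hw⟩ z ∧
        Relation.ReflTransGen (fun a b => 0 < censor P p a b) z y) := by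
    intro w
    induction hirr w y.1 using Relation.TransGen.head_induction_on with
    | single h => exact ⟨fun hw => .single (direct _ _ h), fun hw => ⟨y, enter _ _ h, .refl⟩⟩
    | @head w v h _ ih =>
      by_cases hv : p v
      · exact ⟨fun hw => .head (direct ⟨w, hw⟩ ⟨v, hv⟩ h) (ih.1 hv),
          fun hw => ⟨⟨v, hv⟩, enter ⟨w, hw⟩ ⟨v, hv⟩ h, (ih.1 hv).to_reflTransGen⟩⟩
      · obtain ⟨z, hz, hzy⟩ := ih.2 hv
        refine ⟨fun hw => .head' ?_ hzy, fun hw => ⟨z, ?_, hzy⟩⟩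
        · rw [hC]
          exact add_pos_of_nonneg_of_pos (hPnn _ _)
            (Matrix.mul_apply_pos hUnn hNDnn (y := ⟨v, hv⟩) h hz)
        · rw [hND]
          exact add_pos_of_nonneg_of_pos (hDnn _ _)
            (Matrix.mul_apply_pos hQnn hNDnn (y := ⟨v, hv⟩) h hz)
  exact (key x.1).1 x.2
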